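/- (Conservation between shock-free characteristics.) Let t₀ > 0, x₁, x₂ ∈ ℝ, and let c ∈ 𝒰(x₁,t₀) and d ∈ 𝒰(x₂,t₀). Then for every t ∈ (0, t₀]: t·c·(f'(d) − f'(c)) ≤ ∫_{x₁+(t−t₀)·f'(c)}^{x₂+(t−t₀)·f'(d)} u⁺(x,t) dx − ∫_{x₁−t₀·f'(c)}^{x₂−t₀·f'(d)} φ(x) dx ≤ t·d·(f'(d) − f'(c)). In particular, if c = d, then ∫_{x₁+(t−t₀)·f'(c)}^{x₂+(t−t₀)·f'(c)} u⁺(x,t) dx = ∫_{x₁−t₀·f'(c)}^{x₂−t₀·f'(c)} φ(x) dx for every t ∈ (0, t₀]. -/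

import Mathlib

open MeasureTheory Filter Set

noncomputable def eFun (f φ : ℝ → ℝ) (u x t : ℝ) : ℝ :=
  t * (∫ s in (0:ℝ)..u, deriv (deriv f) s * (φ (x - t * deriv f s) - s))

def maxSet (f φ : ℝ → ℝ) (x t : ℝ) : Set ℝ :=
  {w : ℝ | ∀ v : ℝ, eFun f φ v x t ≤ eFun f φ w x t}

noncomputable def uPlus (f φ : ℝ → ℝ) (x t : ℝ) : ℝ := sInf (maxSet f φ x t)

noncomputable def uMinus (f φ : ℝ → ℝ) (x t : ℝ) : ℝ := sSup (maxSet f φ x t)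

/-- The Legendre transform of `f`, expressed in the variable `u` dual to the speed `f' u`. -/
noncomputable def legendre (f : ℝ → ℝ) (u : ℝ) : ℝ := u * deriv f u - f u

/-- The Hopf–Lax cost of reaching `(x, t)` along the characteristic carrying the value `u`. -/
noncomputable def hopfLaxCost (f φ : ℝ → ℝ) (x t u : ℝ) : ℝ :=
  (∫ y in (0:ℝ)..(x - t * deriv f u), φ y) + t * legendre f u

/-- The Hopf–Lax value function. -/
noncomputable def hopfLaxValue (f φ : ℝ → ℝ) (t x : ℝ) : ℝ :=
  hopfLaxCost f φ x t (uPlus f φ x t)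

section Flux

variable {f : ℝ → ℝ}

theorem hasDerivAt_of_contDiff_two (hf : ContDiff ℝ 2 f) (u : ℝ) :
    HasDerivAt f (deriv f u) u :=
  (hf.differentiable (by norm_num) u).hasDerivAt

theorem contDiff_one_deriv (hf : ContDiff ℝ 2 f) : ContDiff ℝ 1 (deriv f) := by
  have h : ContDiff ℝ (1 + 1) f := by simpa [one_add_one_eq_two] using hf
  exact (contDiff_succ_iff_deriv.1 h).2.2

theorem hasDerivAt_deriv_of_contDiff_two (hf : ContDiff ℝ 2 f) (u : ℝ) :
    HasDerivAt (deriv f) (deriv (deriv f) u) u :=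
  ((contDiff_one_deriv hf).differentiable (by norm_num) u).hasDerivAt

theorem continuous_deriv_deriv (hf : ContDiff ℝ 2 f) : Continuous (deriv (deriv f)) :=
  (contDiff_one_deriv hf).continuous_deriv (by norm_num)

theorem strictMono_deriv_of_ae_pos (hf : ContDiff ℝ 2 f)
    (hconv : ∀ u : ℝ, 0 ≤ deriv (deriv f) u)
    (hdeg : volume {u : ℝ | deriv (deriv f) u = 0} = 0) : StrictMono (deriv f) := by
  have hmono : Monotone (deriv f) :=
    monotone_of_deriv_nonneg ((contDiff_one_deriv hf).differentiable (by norm_num)) hconv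
  intro a b hab
  refine lt_of_le_of_ne (hmono hab.le) fun heq => ?_
  have hsub : Ioo a b ⊆ {u : ℝ | deriv (deriv f) u = 0} := by
    intro u hu
    have hev : deriv f =ᶠ[nhds u] fun _ => deriv f a := by
      filter_upwards [Ioo_mem_nhds hu.1 hu.2] with s hs
      exact le_antisymm (heq ▸ hmono hs.2.le) (hmono hs.1.le)
    simpa using hev.deriv_eq
  have h0 := measure_mono_null hsub hdeg
  rw [Real.volume_Ioo, ENNReal.ofReal_eq_zero] at h0
  linarith

/-- The graph of `f` lies strictly above each tangent line, away from the contact point. -/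
theorem tangent_lt_of_strictMono_deriv (hf : ContDiff ℝ 2 f) (hmono : StrictMono (deriv f))
    {v w : ℝ} (hvw : v ≠ w) : f v + deriv f v * (w - v) < f w := by
  have hd : Differentiable ℝ f := hf.differentiable (by norm_num)
  rcases lt_or_gt_of_ne hvw with h | h
  · obtain ⟨ξ, hξ, he⟩ := exists_deriv_eq_slope f h hd.continuous.continuousOn
      hd.differentiableOn
    have h1 := hmono hξ.1
    rw [he, lt_div_iff₀ (by linarith)] at h1
    linarith
  · obtain ⟨ξ, hξ, he⟩ := exists_deriv_eq_slope f h hd.continuous.continuousOn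
      hd.differentiableOn
    have h1 := hmono hξ.2
    rw [he, div_lt_iff₀ (by linarith)] at h1
    linarith

theorem mul_deriv_sub_lt_legendre_sub (hf : ContDiff ℝ 2 f) (hmono : StrictMono (deriv f))
    {v w : ℝ} (hvw : v ≠ w) :
    w * (deriv f v - deriv f w) < legendre f v - legendre f w := by
  have := tangent_lt_of_strictMono_deriv hf hmono hvw
  unfold legendre
  linarith

theorem mul_deriv_sub_le_legendre_sub (hf : ContDiff ℝ 2 f) (hmono : StrictMono (deriv f))
    (v w : ℝ) : w * (deriv f v - deriv f w) ≤ legendre f v - legendre f w := by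
  rcases eq_or_ne v w with rfl | h
  · simp
  · exact (mul_deriv_sub_lt_legendre_sub hf hmono h).le

theorem hasDerivAt_legendre (hf : ContDiff ℝ 2 f) (u : ℝ) :
    HasDerivAt (legendre f) (u * deriv (deriv f) u) u := by
  have h := ((hasDerivAt_id u).mul (hasDerivAt_deriv_of_contDiff_two hf u)).sub
    (hasDerivAt_of_contDiff_two hf u)
  refine h.congr_deriv ?_
  simp

theorem continuous_legendre (hf : ContDiff ℝ 2 f) : Continuous (legendre f) :=
  continuous_iff_continuousAt.2 fun u => (hasDerivAt_legendre hf u).continuousAt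

end Flux

section Cost

variable {f φ : ℝ → ℝ} {M : ℝ}

theorem intervalIntegrable_of_measurable_of_bounded (hφ : Measurable φ)
    (hM : ∀ x, |φ x| ≤ M) (a b : ℝ) : IntervalIntegrable φ volume a b := by
  refine (intervalIntegrable_const (c := M)).mono_fun hφ.aestronglyMeasurable ?_
  exact Eventually.of_forall fun x => (hM x).trans (le_abs_self M)

theorem abs_primitive_sub_le (hφ : Measurable φ) (hM : ∀ x, |φ x| ≤ M) (a b : ℝ) :
    |(∫ y in (0:ℝ)..a, φ y) - ∫ y in (0:ℝ)..b, φ y| ≤ M * |a - b| := by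
  have hi := intervalIntegrable_of_measurable_of_bounded hφ hM
  rw [intervalIntegral.integral_interval_sub_left (hi 0 a) (hi 0 b)]
  exact intervalIntegral.norm_integral_le_of_norm_le_const (f := φ) fun x _ => hM x

theorem eFun_eq_hopfLaxCost_sub (hf : ContDiff ℝ 2 f) (hconv : ∀ u : ℝ, 0 ≤ deriv (deriv f) u)
    (hφ : Measurable φ) (hM : ∀ x, |φ x| ≤ M) {t : ℝ} (ht : 0 < t) (x u : ℝ) :
    eFun f φ u x t = hopfLaxCost f φ x t 0 - hopfLaxCost f φ x t u := by
  have hi := intervalIntegrable_of_measurable_of_bounded hφ hM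
  have hg (s : ℝ) : HasDerivAt (fun s => x - t * deriv f s) (-(t * deriv (deriv f) s)) s := by
    simpa using ((hasDerivAt_deriv_of_contDiff_two hf s).const_mul t).const_sub x
  have hsub := intervalIntegral.integral_comp_mul_deriv_of_deriv_nonpos (a := 0) (b := u)
    (f := fun s => x - t * deriv f s) (f' := fun s => -(t * deriv (deriv f) s)) (g := φ)
    (fun s _ => (hg s).continuousAt.continuousWithinAt) (fun s _ => hg s)
    (fun s _ => neg_nonpos.2 (mul_nonneg ht.le (hconv s)))
  have hleg : ∫ s in (0:ℝ)..u, s * deriv (deriv f) s = legendre f u - legendre f 0 :=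
    intervalIntegral.integral_eq_sub_of_hasDerivAt (fun s _ => hasDerivAt_legendre hf s)
      ((continuous_id.mul (continuous_deriv_deriv hf)).intervalIntegrable _ _)
  have hcont := (contDiff_one_deriv hf).continuous
  have hφi : IntervalIntegrable (fun s => φ (x - t * deriv f s)) volume 0 u :=
    intervalIntegrable_of_measurable_of_bounded
      (hφ.comp (by fun_prop : Continuous fun s => x - t * deriv f s).measurable)
      (fun s => hM _) _ _
  have hi1 : IntervalIntegrable
      (fun s => deriv (deriv f) s * φ (x - t * deriv f s)) volume 0 u :=
    hφi.continuousOn_mul (continuous_deriv_deriv hf).continuousOn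
  have hi2 : IntervalIntegrable (fun s => s * deriv (deriv f) s) volume 0 u :=
    (continuous_id.mul (continuous_deriv_deriv hf)).intervalIntegrable _ _
  have hsplit : (∫ s in (0:ℝ)..u, deriv (deriv f) s * (φ (x - t * deriv f s) - s))
      = (∫ s in (0:ℝ)..u, deriv (deriv f) s * φ (x - t * deriv f s))
        - ∫ s in (0:ℝ)..u, s * deriv (deriv f) s := by
    rw [← intervalIntegral.integral_sub hi1 hi2]
    exact intervalIntegral.integral_congr fun s _ => by ring
  have hscale : (∫ s in (0:ℝ)..u,
        (φ ∘ fun s => x - t * deriv f s) s * -(t * deriv (deriv f) s))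
      = -t * ∫ s in (0:ℝ)..u, deriv (deriv f) s * φ (x - t * deriv f s) := by
    rw [← intervalIntegral.integral_const_mul]
    exact intervalIntegral.integral_congr fun s _ => by simp only [Function.comp]; ring
  rw [hscale, ← intervalIntegral.integral_interval_sub_left (hi 0 _) (hi 0 _)] at hsub
  unfold eFun hopfLaxCost
  rw [hsplit, hleg]
  linarith

theorem mem_maxSet_iff (hf : ContDiff ℝ 2 f) (hconv : ∀ u : ℝ, 0 ≤ deriv (deriv f) u)
    (hφ : Measurable φ) (hM : ∀ x, |φ x| ≤ M) {t : ℝ} (ht : 0 < t) {x w : ℝ} :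
    w ∈ maxSet f φ x t ↔ ∀ v, hopfLaxCost f φ x t w ≤ hopfLaxCost f φ x t v := by
  simp only [maxSet, mem_ofPred_eq, eFun_eq_hopfLaxCost_sub hf hconv hφ hM ht]
  exact forall_congr' fun v => sub_le_sub_iff_left _

theorem continuous_primitive (hφ : Measurable φ) (hM : ∀ x, |φ x| ≤ M) :
    Continuous fun a => ∫ y in (0:ℝ)..a, φ y :=
  intervalIntegral.continuous_primitive (intervalIntegrable_of_measurable_of_bounded hφ hM) 0

theorem continuous_hopfLaxCost (hf : ContDiff ℝ 2 f) (hφ : Measurable φ)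
    (hM : ∀ x, |φ x| ≤ M) (x t : ℝ) : Continuous (hopfLaxCost f φ x t) := by
  have hcont := (contDiff_one_deriv hf).continuous
  exact ((continuous_primitive hφ hM).comp (by fun_prop : Continuous fun u => x - t * deriv f u)).add
    (continuous_const.mul (continuous_legendre hf))

theorem hopfLaxCost_lt_of_lt (hf : ContDiff ℝ 2 f) (hmono : StrictMono (deriv f))
    (hφ : Measurable φ) (hM : ∀ x, |φ x| ≤ M) {t : ℝ} (ht : 0 < t) (x : ℝ) {v : ℝ}
    (hv : M < v) : hopfLaxCost f φ x t M < hopfLaxCost f φ x t v := by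
  have h1 := mul_lt_mul_of_pos_left (mul_deriv_sub_lt_legendre_sub hf hmono hv.ne') ht
  have h2 := abs_primitive_sub_le hφ hM (x - t * deriv f M) (x - t * deriv f v)
  have h3 : 0 < t * (deriv f v - deriv f M) := mul_pos ht (sub_pos.2 (hmono hv))
  rw [show x - t * deriv f M - (x - t * deriv f v) = t * (deriv f v - deriv f M) by ring,
    abs_of_pos h3] at h2
  have h4 := (abs_le.1 h2).2
  unfold hopfLaxCost
  linarith

theorem hopfLaxCost_lt_of_lt_neg (hf : ContDiff ℝ 2 f) (hmono : StrictMono (deriv f))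
    (hφ : Measurable φ) (hM : ∀ x, |φ x| ≤ M) {t : ℝ} (ht : 0 < t) (x : ℝ) {v : ℝ}
    (hv : v < -M) : hopfLaxCost f φ x t (-M) < hopfLaxCost f φ x t v := by
  have h1 := mul_lt_mul_of_pos_left (mul_deriv_sub_lt_legendre_sub hf hmono hv.ne) ht
  have h2 := abs_primitive_sub_le hφ hM (x - t * deriv f v) (x - t * deriv f (-M))
  have h3 : 0 < t * (deriv f (-M) - deriv f v) := mul_pos ht (sub_pos.2 (hmono hv))
  rw [show x - t * deriv f v - (x - t * deriv f (-M)) = t * (deriv f (-M) - deriv f v) by ring,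
    abs_of_pos h3] at h2
  have h4 := (abs_le.1 h2).1
  unfold hopfLaxCost
  linarith

theorem uPlus_mem_maxSet (hf : ContDiff ℝ 2 f) (hconv : ∀ u : ℝ, 0 ≤ deriv (deriv f) u)
    (hmono : StrictMono (deriv f)) (hφ : Measurable φ) (hM : ∀ x, |φ x| ≤ M) {t : ℝ}
    (ht : 0 < t) (x : ℝ) : uPlus f φ x t ∈ maxSet f φ x t := by
  have hM0 : 0 ≤ M := (abs_nonneg _).trans (hM 0)
  have hcont := continuous_hopfLaxCost hf hφ hM x t
  have hiff {w : ℝ} := mem_maxSet_iff (w := w) (x := x) hf hconv hφ hM ht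
  have hne : (maxSet f φ x t).Nonempty := by
    obtain ⟨w, -, hw⟩ := (isCompact_Icc (a := -M) (b := M)).exists_isMinOn
      ⟨0, by simpa using hM0⟩ hcont.continuousOn
    refine ⟨w, hiff.2 fun v => ?_⟩
    rcases lt_or_ge v (-M) with h | h
    · exact (hw (left_mem_Icc.2 (by linarith))).trans
        (hopfLaxCost_lt_of_lt_neg hf hmono hφ hM ht x h).le
    rcases lt_or_ge M v with h' | h'
    · exact (hw (right_mem_Icc.2 (by linarith))).trans
        (hopfLaxCost_lt_of_lt hf hmono hφ hM ht x h').le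
    · exact hw ⟨h, h'⟩
  have hclosed : IsClosed (maxSet f φ x t) := by
    have : maxSet f φ x t = ⋂ v, {w | hopfLaxCost f φ x t w ≤ hopfLaxCost f φ x t v} := by
      ext w
      simpa using hiff
    rw [this]
    exact isClosed_iInter fun v => isClosed_le hcont continuous_const
  have hbdd : BddBelow (maxSet f φ x t) := by
    refine ⟨-M, fun w hw => ?_⟩
    by_contra! h
    exact (hiff.1 hw (-M)).not_gt (hopfLaxCost_lt_of_lt_neg hf hmono hφ hM ht x h)
  exact hclosed.csInf_mem hne hbdd

theorem hopfLaxValue_le (hf : ContDiff ℝ 2 f) (hconv : ∀ u : ℝ, 0 ≤ deriv (deriv f) u)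
    (hmono : StrictMono (deriv f)) (hφ : Measurable φ) (hM : ∀ x, |φ x| ≤ M) {t : ℝ}
    (ht : 0 < t) (x v : ℝ) : hopfLaxValue f φ t x ≤ hopfLaxCost f φ x t v :=
  (mem_maxSet_iff hf hconv hφ hM ht).1 (uPlus_mem_maxSet hf hconv hmono hφ hM ht x) v

theorem hopfLaxValue_sub_le (hf : ContDiff ℝ 2 f) (hconv : ∀ u : ℝ, 0 ≤ deriv (deriv f) u)
    (hmono : StrictMono (deriv f)) (hφ : Measurable φ) (hM : ∀ x, |φ x| ≤ M) {t : ℝ}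
    (ht : 0 < t) (x y : ℝ) :
    hopfLaxValue f φ t x - hopfLaxValue f φ t y ≤ M * |x - y| := by
  have h1 := hopfLaxValue_le hf hconv hmono hφ hM ht x (uPlus f φ y t)
  have h2 := (le_abs_self _).trans (abs_primitive_sub_le hφ hM
    (x - t * deriv f (uPlus f φ y t)) (y - t * deriv f (uPlus f φ y t)))
  rw [sub_sub_sub_cancel_right] at h2
  have h3 : hopfLaxValue f φ t y = hopfLaxCost f φ y t (uPlus f φ y t) := rfl
  unfold hopfLaxCost at h1 h3
  linarith

theorem lipschitzWith_hopfLaxValue (hf : ContDiff ℝ 2 f)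
    (hconv : ∀ u : ℝ, 0 ≤ deriv (deriv f) u)
    (hmono : StrictMono (deriv f)) (hφ : Measurable φ) (hM : ∀ x, |φ x| ≤ M) {t : ℝ}
    (ht : 0 < t) : LipschitzWith M.toNNReal (hopfLaxValue f φ t) := by
  refine LipschitzWith.of_dist_le_mul fun x y => ?_
  rw [Real.coe_toNNReal M ((abs_nonneg _).trans (hM 0)), Real.dist_eq, Real.dist_eq, abs_le]
  have h1 := hopfLaxValue_sub_le hf hconv hmono hφ hM ht x y
  have h2 := hopfLaxValue_sub_le hf hconv hmono hφ hM ht y x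
  rw [abs_sub_comm] at h2
  constructor <;> linarith

/-- Perturbing the endpoint while keeping the foot of the characteristic fixed. -/
theorem hopfLaxValue_perturb_sub_le (hf : ContDiff ℝ 2 f)
    (hconv : ∀ u : ℝ, 0 ≤ deriv (deriv f) u)
    (hmono : StrictMono (deriv f)) (hφ : Measurable φ) (hM : ∀ x, |φ x| ≤ M) {t : ℝ}
    (ht : 0 < t) (x s : ℝ) :
    hopfLaxValue f φ t (x + t * (deriv f s - deriv f (uPlus f φ x t))) - hopfLaxValue f φ t x
      ≤ s * (t * (deriv f s - deriv f (uPlus f φ x t))) := by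
  set u := uPlus f φ x t with hu
  have h1 := hopfLaxValue_le hf hconv hmono hφ hM ht (x + t * (deriv f s - deriv f u)) s
  have h2 := mul_le_mul_of_nonneg_left (mul_deriv_sub_le_legendre_sub hf hmono u s) ht.le
  have h3 : hopfLaxValue f φ t x = hopfLaxCost f φ x t u := rfl
  unfold hopfLaxCost at h1 h3
  rw [show x + t * (deriv f s - deriv f u) - t * deriv f s = x - t * deriv f u by ring] at h1
  linarith

theorem deriv_hopfLaxValue_eq_uPlus (hf : ContDiff ℝ 2 f)
    (hconv : ∀ u : ℝ, 0 ≤ deriv (deriv f) u)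
    (hmono : StrictMono (deriv f)) (hφ : Measurable φ) (hM : ∀ x, |φ x| ≤ M) {t : ℝ}
    (ht : 0 < t) {x : ℝ} (hx : DifferentiableAt ℝ (hopfLaxValue f φ t) x) :
    deriv (hopfLaxValue f φ t) x = uPlus f φ x t := by
  have hslope := hasDerivAt_iff_tendsto_slope.1 hx.hasDerivAt
  have hp := hopfLaxValue_perturb_sub_le hf hconv hmono hφ hM ht x
  set u := uPlus f φ x t
  set p : ℝ → ℝ := fun s => x + t * (deriv f s - deriv f u) with hpdef
  have hpc : Continuous p := by
    have := (contDiff_one_deriv hf).continuous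
    fun_prop
  have hpt : Tendsto p (nhdsWithin u {u}ᶜ) (nhdsWithin x {x}ᶜ) := by
    refine tendsto_nhdsWithin_iff.2 ⟨?_, ?_⟩
    · have := (hpc.tendsto u).mono_left (nhdsWithin_le_nhds (s := {u}ᶜ))
      simpa [hpdef] using this
    · filter_upwards [self_mem_nhdsWithin] with s hs
      have : deriv f s ≠ deriv f u := hmono.injective.ne hs
      simp [hpdef, ht.ne', sub_eq_zero, this]
  have hcomp := hslope.comp hpt
  have hid : Tendsto (fun s : ℝ => s) (nhds u) (nhds u) := tendsto_id
  apply le_antisymm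
  · refine le_of_tendsto_of_tendsto
      (hcomp.mono_left (nhdsWithin_mono u (s := Ioi u) fun s hs => ne_of_gt hs))
      (hid.mono_left nhdsWithin_le_nhds) ?_
    filter_upwards [self_mem_nhdsWithin] with s hs
    have hpos : 0 < t * (deriv f s - deriv f u) := mul_pos ht (sub_pos.2 (hmono hs))
    simp only [Function.comp, slope_def_field, hpdef, add_sub_cancel_left]
    rw [div_le_iff₀ hpos]
    exact hp s
  · refine le_of_tendsto_of_tendsto (hid.mono_left nhdsWithin_le_nhds)
      (hcomp.mono_left (nhdsWithin_mono u (s := Iio u) fun s hs => ne_of_lt hs)) ?_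
    filter_upwards [self_mem_nhdsWithin] with s hs
    have hneg : t * (deriv f s - deriv f u) < 0 :=
      mul_neg_of_pos_of_neg ht (sub_neg.2 (hmono hs))
    simp only [Function.comp, slope_def_field, hpdef, add_sub_cancel_left]
    rw [le_div_iff_of_neg hneg]
    exact hp s

theorem integral_uPlus_eq_sub (hf : ContDiff ℝ 2 f)
    (hconv : ∀ u : ℝ, 0 ≤ deriv (deriv f) u)
    (hmono : StrictMono (deriv f)) (hφ : Measurable φ) (hM : ∀ x, |φ x| ≤ M) {t : ℝ}
    (ht : 0 < t) (a b : ℝ) :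
    ∫ x in a..b, uPlus f φ x t = hopfLaxValue f φ t b - hopfLaxValue f φ t a := by
  have hL := lipschitzWith_hopfLaxValue hf hconv hmono hφ hM ht
  rw [← (hL.lipschitzOnWith (s := uIcc a b)).absolutelyContinuousOnInterval.integral_deriv_eq_sub]
  refine intervalIntegral.integral_congr_ae ?_
  filter_upwards [hL.ae_differentiableAt_real] with x hx _
  exact (deriv_hopfLaxValue_eq_uPlus hf hconv hmono hφ hM ht hx).symm

/-- A maximizer at `(x₁, t₀)` remains a maximizer at earlier points of its characteristic. -/
theorem mem_maxSet_of_mem_maxSet_of_le (hf : ContDiff ℝ 2 f)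
    (hconv : ∀ u : ℝ, 0 ≤ deriv (deriv f) u)
    (hmono : StrictMono (deriv f)) (hφ : Measurable φ) (hM : ∀ x, |φ x| ≤ M) {t t₀ x₁ c : ℝ}
    (ht : 0 < t) (htt₀ : t ≤ t₀) (hc : c ∈ maxSet f φ x₁ t₀) :
    c ∈ maxSet f φ (x₁ + (t - t₀) * deriv f c) t := by
  have ht₀ : 0 < t₀ := ht.trans_le htt₀
  rw [mem_maxSet_iff hf hconv hφ hM ht₀] at hc
  rw [mem_maxSet_iff hf hconv hφ hM ht]
  intro v
  obtain ⟨w, hw⟩ : ∃ w, t₀ * deriv f w = t * deriv f v + (t₀ - t) * deriv f c := by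
    have hcont := (contDiff_one_deriv hf).continuous
    have hseg := (isPreconnected_range hcont).ordConnected.convex (mem_range_self v)
      (mem_range_self c) (div_nonneg ht.le ht₀.le) (div_nonneg (sub_nonneg.2 htt₀) ht₀.le)
      (by field_simp; ring)
    obtain ⟨w, hw⟩ := hseg
    refine ⟨w, ?_⟩
    rw [hw]
    simp only [smul_eq_mul]
    field_simp
  have h1 := hc w
  have h2 := mul_le_mul_of_nonneg_left (mul_deriv_sub_le_legendre_sub hf hmono v w) ht.le
  have h3 := mul_le_mul_of_nonneg_left (mul_deriv_sub_le_legendre_sub hf hmono c w)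
    (sub_nonneg.2 htt₀)
  have h4 : w * (t₀ * deriv f w) = w * (t * deriv f v + (t₀ - t) * deriv f c) := by rw [hw]
  unfold hopfLaxCost at h1 ⊢
  rw [show x₁ + (t - t₀) * deriv f c - t * deriv f c = x₁ - t₀ * deriv f c by ring,
    show x₁ + (t - t₀) * deriv f c - t * deriv f v = x₁ - t₀ * deriv f w by rw [hw]; ring]
  linarith

theorem hopfLaxValue_along_characteristic (hf : ContDiff ℝ 2 f)
    (hconv : ∀ u : ℝ, 0 ≤ deriv (deriv f) u)
    (hmono : StrictMono (deriv f)) (hφ : Measurable φ) (hM : ∀ x, |φ x| ≤ M) {t t₀ x₁ c : ℝ}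
    (ht : 0 < t) (htt₀ : t ≤ t₀) (hc : c ∈ maxSet f φ x₁ t₀) :
    hopfLaxValue f φ t (x₁ + (t - t₀) * deriv f c)
      = (∫ y in (0:ℝ)..(x₁ - t₀ * deriv f c), φ y) + t * legendre f c := by
  have hc' := mem_maxSet_of_mem_maxSet_of_le hf hconv hmono hφ hM ht htt₀ hc
  rw [mem_maxSet_iff hf hconv hφ hM ht] at hc'
  rw [le_antisymm (hopfLaxValue_le hf hconv hmono hφ hM ht _ c) (hc' _)]
  unfold hopfLaxCost
  rw [show x₁ + (t - t₀) * deriv f c - t * deriv f c = x₁ - t₀ * deriv f c by ring]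

end Cost

/-- conservation between shock-free backward characteristics. -/
theorem stmt15_conservation_between_characteristics
    (f φ : ℝ → ℝ) (M : ℝ)
    (hf : ContDiff ℝ 2 f)
    (hconv : ∀ u : ℝ, 0 ≤ deriv (deriv f) u)
    (hdeg : volume {u : ℝ | deriv (deriv f) u = 0} = 0)
    (hφmeas : Measurable φ)
    (hφbdd : ∀ x : ℝ, |φ x| ≤ M)
    (t₀ x₁ x₂ c d : ℝ) (ht₀ : 0 < t₀)
    (hc : c ∈ maxSet f φ x₁ t₀) (hd : d ∈ maxSet f φ x₂ t₀) :
    ∀ t : ℝ, 0 < t → t ≤ t₀ →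
      (t * c * (deriv f d - deriv f c)
          ≤ (∫ x in (x₁ + (t - t₀) * deriv f c)..(x₂ + (t - t₀) * deriv f d),
              uPlus f φ x t)
            - ∫ x in (x₁ - t₀ * deriv f c)..(x₂ - t₀ * deriv f d), φ x) ∧
      ((∫ x in (x₁ + (t - t₀) * deriv f c)..(x₂ + (t - t₀) * deriv f d),
            uPlus f φ x t)
          - (∫ x in (x₁ - t₀ * deriv f c)..(x₂ - t₀ * deriv f d), φ x)
          ≤ t * d * (deriv f d - deriv f c)) ∧
      (c = d →
        (∫ x in (x₁ + (t - t₀) * deriv f c)..(x₂ + (t - t₀) * deriv f c),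
            uPlus f φ x t)
          = ∫ x in (x₁ - t₀ * deriv f c)..(x₂ - t₀ * deriv f c), φ x) := by
  intro t ht htt₀
  have hmono := strictMono_deriv_of_ae_pos hf hconv hdeg
  have hi := intervalIntegrable_of_measurable_of_bounded hφmeas hφbdd
  have key : (∫ x in (x₁ + (t - t₀) * deriv f c)..(x₂ + (t - t₀) * deriv f d), uPlus f φ x t)
      - (∫ x in (x₁ - t₀ * deriv f c)..(x₂ - t₀ * deriv f d), φ x)
      = t * (legendre f d - legendre f c) := by
    rw [integral_uPlus_eq_sub hf hconv hmono hφmeas hφbdd ht,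
      hopfLaxValue_along_characteristic hf hconv hmono hφmeas hφbdd ht htt₀ hc,
      hopfLaxValue_along_characteristic hf hconv hmono hφmeas hφbdd ht htt₀ hd,
      ← intervalIntegral.integral_interval_sub_left (hi 0 (x₂ - t₀ * deriv f d))
        (hi 0 (x₁ - t₀ * deriv f c))]
    ring
  have h1 := mul_le_mul_of_nonneg_left (mul_deriv_sub_le_legendre_sub hf hmono d c) ht.le
  have h2 := mul_le_mul_of_nonneg_left (mul_deriv_sub_le_legendre_sub hf hmono c d) ht.le
  refine ⟨by rw [key]; linarith, by rw [key]; linarith, ?_⟩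
  rintro rfl
  rw [sub_self, mul_zero] at key
  exact sub_eq_zero.1 key
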